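/- Let Δ : U(ŝl_{n+1}) → U(ŝl_{n+1}) ⊗_{ℚ(v)} U(ŝl_{n+1}) be any ℚ(v)-algebra homomorphism satisfying Δ(Ĕ_i) = Ĕ_i ⊗ 1 + K̆_i ⊗ Ĕ_i, Δ(F̆_i) = F̆_i ⊗ K̆_i⁻¹ + 1 ⊗ F̆_i, and Δ(K̆_i^{±1}) = K̆_i^{±1} ⊗ K̆_i^{±1} for all i ∈ ℤ/(n+1)ℤ. Then Δ(e_r) = e_r ⊗ 1 + k_r ⊗ e_r + (v⁻¹ − v^ε) Ĕ_{r+1} K̆_r ⊗ Ĕ_r + (v − v^ε) K̆_{r+1} Ĕ_r ⊗ Ĕ_{r+1}, and Δ(f_r) = f_r ⊗ k_r⁻¹ + 1 ⊗ f_r + (v − v^{−ε}) F̆_r ⊗ K̆_r⁻¹ F̆_{r+1} + (v⁻¹ − v^{−ε}) F̆_{r+1} ⊗ F̆_r K̆_{r+1}⁻¹. -/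

import Mathlib

noncomputable section

/-- The field ℚ(v) of rational functions over ℚ. -/
abbrev Qv : Type := RatFunc ℚ

/-- The indeterminate v. -/
def vv : Qv := RatFunc.X

/-- The quantum integer [a] = (v^a - v^{-a})/(v - v⁻¹). -/
def qint (a : ℕ) : Qv := (vv ^ (a : ℤ) - vv ^ (-(a : ℤ))) / (vv - vv⁻¹)

/-- The quantum factorial [a]! = [a][a-1]⋯[1]. -/
def qfact : ℕ → Qv
  | 0 => 1
  | n + 1 => qint (n + 1) * qfact n

/-- Divided power x^{(p)} = x^p / [p]!. -/
def dp {A : Type} [Ring A] [Algebra Qv A] (x : A) (p : ℕ) : A :=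
  (qfact p)⁻¹ • x ^ p

/-- The affine type A Cartan matrix entries c_{ij} = 2δ_{i,j} - δ_{i,j+1} - δ_{i,j-1}. -/
def cartan {m : ℕ} (i j : ZMod m) : ℤ :=
  (if i = j then 2 else 0) - (if i = j + 1 then 1 else 0) - (if i = j - 1 then 1 else 0)

/-- Generators of the quantum affine algebra U(ŝl_m). -/
inductive Gen (m : ℕ) : Type
  | E : ZMod m → Gen m
  | F : ZMod m → Gen m
  | K : ZMod m → Gen m
  | Kinv : ZMod m → Gen m

abbrev FA (m : ℕ) := FreeAlgebra Qv (Gen m)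

def fE {m : ℕ} (i : ZMod m) : FA m := FreeAlgebra.ι Qv (Gen.E i)
def fF {m : ℕ} (i : ZMod m) : FA m := FreeAlgebra.ι Qv (Gen.F i)
def fK {m : ℕ} (i : ZMod m) : FA m := FreeAlgebra.ι Qv (Gen.K i)
def fKinv {m : ℕ} (i : ZMod m) : FA m := FreeAlgebra.ι Qv (Gen.Kinv i)

/-- The defining relations of the quantum affine algebra U(ŝl_m). -/
inductive URel (m : ℕ) : FA m → FA m → Prop
  | KK : ∀ i j, URel m (fK i * fK j) (fK j * fK i)
  | KKinv : ∀ i, URel m (fK i * fKinv i) 1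
  | KinvK : ∀ i, URel m (fKinv i * fK i) 1
  | KE : ∀ i j, URel m (fK i * fE j) (vv ^ cartan i j • (fE j * fK i))
  | KF : ∀ i j, URel m (fK i * fF j) (vv ^ (-cartan i j) • (fF j * fK i))
  | EF : ∀ i j, URel m (fE i * fF j - fF j * fE i)
      (if i = j then (vv - vv⁻¹)⁻¹ • (fK i - fKinv i) else 0)
  | serreE : ∀ i j, i ≠ j →
      URel m (∑ p ∈ Finset.range ((1 - cartan i j).toNat + 1),
        ((-1 : Qv) ^ p) • (dp (fE i) p * fE j * dp (fE i) ((1 - cartan i j).toNat - p))) 0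
  | serreF : ∀ i j, i ≠ j →
      URel m (∑ p ∈ Finset.range ((1 - cartan i j).toNat + 1),
        ((-1 : Qv) ^ p) • (dp (fF i) p * fF j * dp (fF i) ((1 - cartan i j).toNat - p))) 0

/-- The quantum affine algebra U(ŝl_m), presented by generators and relations. -/
abbrev U (m : ℕ) := RingQuot (URel m)

def UE {m : ℕ} (i : ZMod m) : U m := RingQuot.mkAlgHom Qv (URel m) (fE i)
def UF {m : ℕ} (i : ZMod m) : U m := RingQuot.mkAlgHom Qv (URel m) (fF i)
def UK {m : ℕ} (i : ZMod m) : U m := RingQuot.mkAlgHom Qv (URel m) (fK i)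
def UKinv {m : ℕ} (i : ZMod m) : U m := RingQuot.mkAlgHom Qv (URel m) (fKinv i)

/-- The element e_r = Ĕ_r Ĕ_{r+1} − v^ε Ĕ_{r+1} Ĕ_r in U(ŝl_{n+1}). -/
def er (n r : ℕ) (ε : ℤ) : U (n + 1) :=
  UE (r : ZMod (n + 1)) * UE ((r : ZMod (n + 1)) + 1) -
    vv ^ ε • (UE ((r : ZMod (n + 1)) + 1) * UE (r : ZMod (n + 1)))

/-- The element f_r = F̆_{r+1} F̆_r − v^{−ε} F̆_r F̆_{r+1} in U(ŝl_{n+1}). -/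
def fr (n r : ℕ) (ε : ℤ) : U (n + 1) :=
  UF ((r : ZMod (n + 1)) + 1) * UF (r : ZMod (n + 1)) -
    vv ^ (-ε) • (UF (r : ZMod (n + 1)) * UF ((r : ZMod (n + 1)) + 1))

/-- The element k_r = K̆_r K̆_{r+1} in U(ŝl_{n+1}). -/
def kr (n r : ℕ) : U (n + 1) :=
  UK (r : ZMod (n + 1)) * UK ((r : ZMod (n + 1)) + 1)

/-- The image e_i ∈ U(ŝl_{n+1}) of the generator E_i, i ∈ ℤ/nℤ. -/
def eElt (n r : ℕ) (ε : ℤ) (i : ZMod n) : U (n + 1) :=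
  if i.val < r then UE ((i.val : ZMod (n + 1)))
  else if i.val = r then er n r ε
  else UE ((i.val + 1 : ℕ) : ZMod (n + 1))

def fElt (n r : ℕ) (ε : ℤ) (i : ZMod n) : U (n + 1) :=
  if i.val < r then UF ((i.val : ZMod (n + 1)))
  else if i.val = r then fr n r ε
  else UF ((i.val + 1 : ℕ) : ZMod (n + 1))

def kElt (n r : ℕ) (i : ZMod n) : U (n + 1) :=
  if i.val < r then UK ((i.val : ZMod (n + 1)))
  else if i.val = r then kr n r
  else UK ((i.val + 1 : ℕ) : ZMod (n + 1))

def kinvElt (n r : ℕ) (i : ZMod n) : U (n + 1) :=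
  if i.val < r then UKinv ((i.val : ZMod (n + 1)))
  else if i.val = r then UKinv (r : ZMod (n + 1)) * UKinv ((r : ZMod (n + 1)) + 1)
  else UKinv ((i.val + 1 : ℕ) : ZMod (n + 1))


open scoped TensorProduct

theorem vv_ne_zero : vv ≠ 0 := RatFunc.X_ne_zero

theorem UK_mul_UK_comm {m : ℕ} (i j : ZMod m) : UK i * UK j = UK j * UK i := by
  simpa [UK] using RingQuot.mkAlgHom_rel Qv (URel.KK i j)

theorem UK_mul_UKinv {m : ℕ} (i : ZMod m) : UK i * UKinv i = 1 := by
  simpa [UK, UKinv] using RingQuot.mkAlgHom_rel Qv (URel.KKinv i)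

theorem UKinv_mul_UK {m : ℕ} (i : ZMod m) : UKinv i * UK i = 1 := by
  simpa [UK, UKinv] using RingQuot.mkAlgHom_rel Qv (URel.KinvK i)

theorem UK_mul_UE {m : ℕ} (i j : ZMod m) :
    UK i * UE j = vv ^ cartan i j • (UE j * UK i) := by
  simpa [UK, UE] using RingQuot.mkAlgHom_rel Qv (URel.KE i j)

theorem UK_mul_UF {m : ℕ} (i j : ZMod m) :
    UK i * UF j = vv ^ (-cartan i j) • (UF j * UK i) := by
  simpa only [UK, UF, map_mul, map_smul] using RingQuot.mkAlgHom_rel Qv (URel.KF i j)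

theorem UF_mul_UKinv {m : ℕ} (i j : ZMod m) :
    UF j * UKinv i = vv ^ (-cartan i j) • (UKinv i * UF j) := by
  calc UF j * UKinv i = UKinv i * (UK i * UF j) * UKinv i := by
        rw [← mul_assoc, UKinv_mul_UK, one_mul]
    _ = vv ^ (-cartan i j) • (UKinv i * UF j) := by
        rw [UK_mul_UF, mul_smul_comm, smul_mul_assoc, mul_assoc, mul_assoc, UK_mul_UKinv, mul_one]

theorem UKinv_mul_UF {m : ℕ} (i j : ZMod m) :
    UKinv i * UF j = vv ^ cartan i j • (UF j * UKinv i) := by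
  rw [UF_mul_UKinv, smul_smul, ← zpow_add₀ vv_ne_zero, add_neg_cancel, zpow_zero, one_smul]

theorem UKinv_mul_UKinv_comm {m : ℕ} (i j : ZMod m) :
    UKinv i * UKinv j = UKinv j * UKinv i := by
  have h : Commute (UK i) (UK j) := UK_mul_UK_comm i j
  let u (k : ZMod m) : (U m)ˣ := ⟨UK k, UKinv k, UK_mul_UKinv k, UKinv_mul_UK k⟩
  have hu : Commute (u i) (u j) := Units.ext h
  exact congrArg Units.val hu.inv_inv.eq

theorem ZMod.natCast_ne_zero_of_lt {m k : ℕ} (hk : 0 < k) (hkm : k < m) : (k : ZMod m) ≠ 0 := by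
  rw [Ne, ZMod.natCast_eq_zero_iff]
  exact Nat.not_dvd_of_pos_of_lt hk hkm

theorem cartan_self_add_one {m : ℕ} (hm : 3 ≤ m) (i : ZMod m) : cartan i (i + 1) = -1 := by
  have h1 : (1 : ZMod m) ≠ 0 := by
    simpa using ZMod.natCast_ne_zero_of_lt (m := m) (k := 1) (by omega) (by omega)
  have h2 : (1 + 1 : ZMod m) ≠ 0 := by
    simpa [one_add_one_eq_two] using
      ZMod.natCast_ne_zero_of_lt (m := m) (k := 2) (by omega) (by omega)
  simp [cartan, h1, h2, add_assoc]

theorem cartan_add_one_self {m : ℕ} (hm : 3 ≤ m) (i : ZMod m) : cartan (i + 1) i = -1 := by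
  have h1 : (1 : ZMod m) ≠ 0 := by
    simpa using ZMod.natCast_ne_zero_of_lt (m := m) (k := 1) (by omega) (by omega)
  have h2 : (1 + 1 : ZMod m) ≠ 0 := by
    simpa [one_add_one_eq_two] using
      ZMod.natCast_ne_zero_of_lt (m := m) (k := 2) (by omega) (by omega)
  have h3 : i + 1 ≠ i - 1 := fun h => h2 (by linear_combination h)
  simp [cartan, h1, h3]

/-- the comultiplication formulas for e_r and f_r. -/
theorem comultiplication_er_fr
    (n r : ℕ) (hn : 2 ≤ n) (hr : r ≤ n - 1) (ε : ℤ) (hε : ε = 1 ∨ ε = -1)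
    (Δ : U (n + 1) →ₐ[Qv] (U (n + 1) ⊗[Qv] U (n + 1)))
    (hE : ∀ i : ZMod (n + 1), Δ (UE i) = UE i ⊗ₜ[Qv] 1 + UK i ⊗ₜ[Qv] UE i)
    (hF : ∀ i : ZMod (n + 1), Δ (UF i) = UF i ⊗ₜ[Qv] UKinv i + 1 ⊗ₜ[Qv] UF i)
    (hK : ∀ i : ZMod (n + 1), Δ (UK i) = UK i ⊗ₜ[Qv] UK i)
    (hKinv : ∀ i : ZMod (n + 1), Δ (UKinv i) = UKinv i ⊗ₜ[Qv] UKinv i) :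
    Δ (er n r ε) =
      er n r ε ⊗ₜ[Qv] 1 + kr n r ⊗ₜ[Qv] er n r ε +
        (vv⁻¹ - vv ^ ε) •
          ((UE ((r : ZMod (n + 1)) + 1) * UK (r : ZMod (n + 1))) ⊗ₜ[Qv] UE (r : ZMod (n + 1))) +
        (vv - vv ^ ε) •
          ((UK ((r : ZMod (n + 1)) + 1) * UE (r : ZMod (n + 1))) ⊗ₜ[Qv]
            UE ((r : ZMod (n + 1)) + 1)) ∧
    Δ (fr n r ε) =
      fr n r ε ⊗ₜ[Qv] (UKinv (r : ZMod (n + 1)) * UKinv ((r : ZMod (n + 1)) + 1)) +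
        1 ⊗ₜ[Qv] fr n r ε +
        (vv - vv ^ (-ε)) •
          (UF (r : ZMod (n + 1)) ⊗ₜ[Qv]
            (UKinv (r : ZMod (n + 1)) * UF ((r : ZMod (n + 1)) + 1))) +
        (vv⁻¹ - vv ^ (-ε)) •
          (UF ((r : ZMod (n + 1)) + 1) ⊗ₜ[Qv]
            (UF (r : ZMod (n + 1)) * UKinv ((r : ZMod (n + 1)) + 1))) := by
  have hm : 3 ≤ n + 1 := by omega
  set a : ZMod (n + 1) := (r : ZMod (n + 1)) with ha
  have hKE : UK a * UE (a + 1) = vv⁻¹ • (UE (a + 1) * UK a) := by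
    rw [UK_mul_UE, cartan_self_add_one hm, zpow_neg_one]
  have hEK : UE a * UK (a + 1) = vv • (UK (a + 1) * UE a) := by
    rw [UK_mul_UE, cartan_add_one_self hm, zpow_neg_one, smul_inv_smul₀ vv_ne_zero]
  have hFK : UF (a + 1) * UKinv a = vv • (UKinv a * UF (a + 1)) := by
    rw [UF_mul_UKinv, cartan_self_add_one hm, neg_neg, zpow_one]
  have hKF : UKinv (a + 1) * UF a = vv⁻¹ • (UF a * UKinv (a + 1)) := by
    rw [UKinv_mul_UF, cartan_add_one_self hm, zpow_neg_one]
  constructor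
  · simp only [er, kr, ← ha, map_sub, map_mul, map_smul, hE, add_mul, mul_add,
      Algebra.TensorProduct.tmul_mul_tmul, mul_one, one_mul, hKE, hEK, UK_mul_UK_comm (a + 1) a,
      TensorProduct.sub_tmul, TensorProduct.tmul_sub, TensorProduct.smul_tmul',
      TensorProduct.tmul_smul, sub_smul, smul_add]
    abel
  · simp only [fr, ← ha, map_sub, map_mul, map_smul, hF, add_mul, mul_add,
      Algebra.TensorProduct.tmul_mul_tmul, mul_one, one_mul, hFK, hKF,
      UKinv_mul_UKinv_comm (a + 1) a,
      TensorProduct.sub_tmul, TensorProduct.tmul_sub, TensorProduct.smul_tmul',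
      TensorProduct.tmul_smul, sub_smul, smul_add]
    abel

end
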